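/- arXiv:2512.16681 — 2 statements merged into one kernel-verified Lean document; each statement's English description precedes it below -/
import Mathlib

section
/- For real s > 1 and real m ∈ (−1,1), the following identity holds: log((s−1/2)²) + ∫₀^∞ λ f(m,λ)/(λ² + (s−1/2)²) dλ = ψ(s + m/2) + ψ(s − m/2), where f(m,λ) = 2/(1+e^{2π(λ+im/2)}) + 2/(1+e^{2π(λ−im/2)}) and ψ = Γ'/Γ is the digamma function. -/
open MeasureTheory Real

/-- The function `f(m,λ)` from the identity contribution of the trace formula. -/
noncomputable def fId (m lam : ℝ) : ℝ :=
  4 * (1 + Real.exp (2 * π * lam) * Real.cos (π * m)) /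
    (Real.exp (4 * π * lam) + 2 * Real.exp (2 * π * lam) * Real.cos (π * m) + 1)

/-- The digamma function `ψ = Γ'/Γ`. -/
noncomputable def digamma (x : ℝ) : ℝ := deriv Real.Gamma x / Real.Gamma x


lemma aux_ne {x : ℝ} (hx : 0 < x) : ∀ n : ℕ, x ≠ -(n : ℝ) := by
  intro n
  have : (0 : ℝ) ≤ n := Nat.cast_nonneg n
  linarith

lemma hasDerivAt_logGamma {x : ℝ} (hx : 0 < x) :
    HasDerivAt (Real.log ∘ Real.Gamma) (digamma x) x :=
  (Real.differentiableAt_Gamma (aux_ne hx)).hasDerivAt.log (Real.Gamma_pos_of_pos hx).ne'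

lemma digamma_add_one {x : ℝ} (hx : 0 < x) : digamma (x + 1) = digamma x + 1 / x := by
  have h1 : HasDerivAt (fun y : ℝ => (Real.log ∘ Real.Gamma) (y + 1)) (digamma (x + 1)) x := by
    have := (hasDerivAt_logGamma (show 0 < x + 1 by linarith))
    exact this.comp_add_const x 1
  have h2 : HasDerivAt (fun y : ℝ => (Real.log ∘ Real.Gamma) y + Real.log y)
      (digamma x + 1 / x) x := by
    have := (hasDerivAt_logGamma hx).add (Real.hasDerivAt_log hx.ne')
    rw [one_div]; exact this
  refine h1.unique (h2.congr_of_eventuallyEq ?_)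
  filter_upwards [lt_mem_nhds hx] with y hy
  simp only [Function.comp]
  rw [Real.Gamma_add_one hy.ne', Real.log_mul hy.ne' (Real.Gamma_pos_of_pos hy).ne', add_comm]

lemma digamma_mono : MonotoneOn digamma (Set.Ioi 0) := by
  have h := Real.convexOn_log_Gamma.monotoneOn_deriv
    (fun x hx => (hasDerivAt_logGamma hx).differentiableAt)
  intro x hx y hy hxy
  have := h hx hy hxy
  rwa [(hasDerivAt_logGamma hx).deriv, (hasDerivAt_logGamma hy).deriv] at this

lemma digamma_cont : ContinuousOn digamma (Set.Ioi 0) := by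
  have hd : DifferentiableOn ℂ Complex.Gamma {z : ℂ | 0 < z.re} := by
    intro z hz
    refine (Complex.differentiableAt_Gamma z ?_).differentiableWithinAt
    rintro n rfl
    have h0 : (0 : ℝ) ≤ n := Nat.cast_nonneg n
    simp at hz
    linarith
  have ho : IsOpen {z : ℂ | 0 < z.re} := isOpen_lt continuous_const Complex.continuous_re
  have hc : ContinuousOn (deriv Complex.Gamma) {z : ℂ | 0 < z.re} := (hd.deriv ho).continuousOn
  have he : ∀ x ∈ Set.Ioi (0 : ℝ), deriv Real.Gamma x = (deriv Complex.Gamma (x : ℂ)).re := by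
    intro x hx
    have h1 : HasDerivAt Complex.Gamma (deriv Complex.Gamma (x : ℂ)) (x : ℂ) :=
      ((hd x (by simpa using hx)).differentiableAt (ho.mem_nhds (by simpa using hx))).hasDerivAt
    have h2 := h1.real_of_complex
    exact h2.deriv
  have hg : ContinuousOn (deriv Real.Gamma) (Set.Ioi 0) := by
    refine ContinuousOn.congr ?_ he
    refine Complex.continuous_re.comp_continuousOn (hc.comp Complex.continuous_ofReal.continuousOn ?_)
    intro x hx
    simpa using hx
  exact hg.div Real.differentiableOn_Gamma_Ioi.continuousOn
    (fun x hx => (Real.Gamma_pos_of_pos hx).ne')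

lemma integral_digamma {a : ℝ} (ha : 0 < a) : ∫ y in (0 : ℝ)..1, digamma (a + y) = Real.log a := by
  have hpos : ∀ y ∈ Set.uIcc (0 : ℝ) 1, 0 < a + y := by
    intro y hy
    rw [Set.uIcc_of_le zero_le_one] at hy
    linarith [hy.1]
  rw [intervalIntegral.integral_eq_sub_of_hasDerivAt
    (f := fun y => (Real.log ∘ Real.Gamma) (a + y))]
  · simp only [Function.comp, add_zero]
    rw [Real.Gamma_add_one ha.ne', Real.log_mul ha.ne' (Real.Gamma_pos_of_pos ha).ne']
    ring
  · intro y hy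
    exact (hasDerivAt_logGamma (hpos y hy)).comp_const_add a y
  · refine ContinuousOn.intervalIntegrable ?_
    exact digamma_cont.comp (by fun_prop) (fun y hy => hpos y hy)

lemma integral_t_exp {b : ℝ} (hb : 0 < b) :
    ∫ t in Set.Ioi (0 : ℝ), t * Real.exp (-b * t) = 1 / b ^ 2 := by
  have h := Real.integral_rpow_mul_exp_neg_mul_Ioi (a := 2) (r := b) (by norm_num) hb
  have h2 : (2 : ℝ) - 1 = 1 := by norm_num
  simp only [h2, Real.rpow_one, Real.Gamma_two, mul_one, Real.rpow_two] at h
  simpa [neg_mul] using h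

lemma integrable_t_exp {b : ℝ} (hb : 0 < b) :
    IntegrableOn (fun t : ℝ => t * Real.exp (-b * t)) (Set.Ioi 0) := by
  by_contra h
  have := integral_undef h
  rw [integral_t_exp hb] at this
  have h2 : 1 / b ^ 2 > 0 := by positivity
  linarith

lemma integrable_kernel {a b : ℝ} (ha : 0 < a) (hb : 0 < b) :
    IntegrableOn (fun t : ℝ => t * Real.exp (-b * t) / (t ^ 2 + a ^ 2)) (Set.Ioi 0) := by
  refine Integrable.mono' ((integrable_t_exp hb).div_const (a ^ 2)) ?_ ?_
  · refine ContinuousOn.aestronglyMeasurable ?_ measurableSet_Ioi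
    refine Continuous.continuousOn (Continuous.div (by fun_prop) (by fun_prop) ?_)
    intro t; positivity
  · refine (ae_restrict_iff' measurableSet_Ioi).2 (Filter.Eventually.of_forall fun t ht => ?_)
    have ht : (0 : ℝ) < t := ht
    rw [Real.norm_of_nonneg (by positivity)]
    gcongr
    nlinarith

lemma integral_kernel_le {a b : ℝ} (ha : 0 < a) (hb : 0 < b) :
    ∫ t in Set.Ioi (0 : ℝ), t * Real.exp (-b * t) / (t ^ 2 + a ^ 2) ≤ 1 / (b ^ 2 * a ^ 2) := by
  have : ∫ t in Set.Ioi (0 : ℝ), t * Real.exp (-b * t) / a ^ 2 = 1 / (b ^ 2 * a ^ 2) := by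
    rw [integral_div, integral_t_exp hb]
    field_simp
  rw [← this]
  refine setIntegral_mono_on (integrable_kernel ha hb) ((integrable_t_exp hb).div_const _)
    measurableSet_Ioi ?_
  intro t ht
  have ht : (0 : ℝ) < t := ht
  gcongr
  nlinarith

lemma integral_kernel_nonneg (a b : ℝ) :
    0 ≤ ∫ t in Set.Ioi (0 : ℝ), t * Real.exp (-b * t) / (t ^ 2 + a ^ 2) := by
  refine setIntegral_nonneg measurableSet_Ioi fun t ht => ?_
  have ht : (0 : ℝ) < t := ht
  positivity

lemma kernel_swap {a c : ℝ} (ha : 0 < a) (hc : 0 < c) :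
    ∫ t in Set.Ioi (0 : ℝ), t * Real.exp (-a * t) / (t ^ 2 + c ^ 2) =
    ∫ t in Set.Ioi (0 : ℝ), t * Real.exp (-c * t) / (t ^ 2 + a ^ 2) := by
  have h := integral_comp_mul_left_Ioi'
    (fun t => t * Real.exp (-a * t) / (t ^ 2 + c ^ 2)) 0 (b := c / a) (by positivity)
  rw [mul_zero] at h
  rw [← h, ← integral_smul]
  refine setIntegral_congr_fun measurableSet_Ioi fun t ht => ?_
  have ht : (0 : ℝ) < t := ht
  have e : -a * (c / a * t) = -c * t := by field_simp
  simp only [e, smul_eq_mul]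
  have h1 : (t ^ 2 + a ^ 2) ≠ 0 := by positivity
  have h2 : (c / a * t) ^ 2 + c ^ 2 = c ^ 2 / a ^ 2 * (t ^ 2 + a ^ 2) := by field_simp
  rw [h2]
  field_simp

/-- the inner integral -/
lemma inner_integral {c t : ℝ} (ht : 0 < t) (k N : ℕ) (hck : c = 2 * π * k) :
    ∫ y in (0 : ℝ)..N, Real.exp (-t * y) * Real.cos (c * y) =
      t * (1 - Real.exp (-t * N)) / (t ^ 2 + c ^ 2) := by
  have hp : t ^ 2 + c ^ 2 ≠ 0 := by positivity
  rw [intervalIntegral.integral_eq_sub_of_hasDerivAt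
    (f := fun y => Real.exp (-t * y) * (c * Real.sin (c * y) - t * Real.cos (c * y))
      / (t ^ 2 + c ^ 2))]
  · have e : c * (N : ℝ) = ((k * N : ℕ) : ℝ) * (2 * π) := by rw [hck]; push_cast; ring
    rw [e, Real.cos_nat_mul_two_pi]
    have e2 : Real.sin (((k * N : ℕ) : ℝ) * (2 * π)) = 0 := by
      have := Real.sin_nat_mul_pi (2 * (k * N))
      rw [← this]; push_cast; ring_nf
    rw [e2]
    simp
    field_simp
    ring
  · intro y _
    have h1 : HasDerivAt (fun y : ℝ => Real.exp (-t * y)) (Real.exp (-t * y) * (-t)) y := by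
      simpa using ((hasDerivAt_id y).const_mul (-t)).exp
    have h2 : HasDerivAt (fun y : ℝ => Real.sin (c * y)) (Real.cos (c * y) * c) y := by
      simpa using ((hasDerivAt_id y).const_mul c).sin
    have h3 : HasDerivAt (fun y : ℝ => Real.cos (c * y)) (-Real.sin (c * y) * c) y := by
      simpa using ((hasDerivAt_id y).const_mul c).cos
    have h := (h1.mul ((h2.const_mul c).sub (h3.const_mul t))).div_const (t ^ 2 + c ^ 2)
    refine h.congr_deriv ?_
    field_simp
    simp only [Pi.sub_apply]
    ring
  · exact Continuous.intervalIntegrable (by fun_prop) _ _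

lemma integral_cos_div {a c : ℝ} (ha : 0 < a) (k N : ℕ) (hck : c = 2 * π * k) :
    ∫ y in (0 : ℝ)..N, Real.cos (c * y) / (a + y) =
      ∫ t in Set.Ioi (0 : ℝ), Real.exp (-a * t) * (t * (1 - Real.exp (-t * N)) / (t ^ 2 + c ^ 2)) := by
  have hN : (0 : ℝ) ≤ N := Nat.cast_nonneg N
  have h1 : ∫ y in (0 : ℝ)..N, Real.cos (c * y) / (a + y) =
      ∫ y in Set.Ioc (0 : ℝ) N, ∫ t in Set.Ioi (0 : ℝ),
        Real.exp (-a * t) * (Real.exp (-t * y) * Real.cos (c * y)) := by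
    rw [intervalIntegral.integral_of_le hN]
    refine setIntegral_congr_fun measurableSet_Ioc fun y hy => ?_
    have hy0 : 0 < y := hy.1
    have e : ∀ t : ℝ, Real.exp (-a * t) * (Real.exp (-t * y) * Real.cos (c * y)) =
        Real.exp (-(a + y) * t) * Real.cos (c * y) := by
      intro t
      rw [← mul_assoc, ← Real.exp_add]; ring_nf
    simp only [e]
    rw [integral_mul_const, integral_exp_mul_Ioi (by linarith)]
    have hne : a + y ≠ 0 := by linarith
    rw [mul_zero, Real.exp_zero, neg_div_neg_eq, div_mul_eq_mul_div, one_mul]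
  rw [h1, integral_integral_swap]
  · refine setIntegral_congr_fun measurableSet_Ioi fun t ht => ?_
    rw [← inner_integral ht k N hck, integral_const_mul, intervalIntegral.integral_of_le hN]
  · have hd : Integrable (fun p : ℝ × ℝ => (1 : ℝ) * Real.exp (-a * p.2))
        ((volume.restrict (Set.Ioc (0 : ℝ) N)).prod (volume.restrict (Set.Ioi (0 : ℝ)))) :=
      Integrable.mul_prod (integrable_const 1) (integrableOn_exp_mul_Ioi (by linarith) 0)
    refine hd.mono' ?_ ?_
    · refine Continuous.aestronglyMeasurable ?_
      simp only [Function.uncurry_def]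
      fun_prop
    · rw [Measure.prod_restrict]
      refine (ae_restrict_iff' (measurableSet_Ioc.prod measurableSet_Ioi)).2
        (Filter.Eventually.of_forall fun p hp => ?_)
      have h1 : 0 < p.1 := hp.1.1
      have h2 : 0 < p.2 := hp.2
      simp only [Function.uncurry_def, norm_mul, Real.norm_eq_abs, Real.abs_exp, one_mul]
      have h3 : Real.exp (-p.2 * p.1) ≤ 1 := Real.exp_le_one_iff.2 (by nlinarith)
      have h4 := Real.abs_cos_le_one (c * p.1)
      have h5 : Real.exp (-p.2 * p.1) * |Real.cos (c * p.1)| ≤ 1 :=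
        mul_le_one₀ h3 (abs_nonneg _) h4
      exact mul_le_of_le_one_right (Real.exp_pos _).le h5

lemma shift_identity {a c : ℝ} (ha : 0 < a) (k : ℕ) (hck : c = 2 * π * k) (N : ℕ) :
    ∫ y in (0 : ℝ)..1, digamma (a + y) * Real.cos (c * y) =
      (∫ y in (0 : ℝ)..1, digamma (a + N + y) * Real.cos (c * y)) -
      ∫ y in (0 : ℝ)..N, Real.cos (c * y) / (a + y) := by
  induction N with
  | zero => simp
  | succ N ih =>
    rw [ih]
    have hN : (0 : ℝ) ≤ N := Nat.cast_nonneg N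
    have hpos : ∀ y ∈ Set.uIcc (0 : ℝ) 1, 0 < a + N + y := by
      intro y hy
      rw [Set.uIcc_of_le zero_le_one] at hy
      linarith [hy.1]
    have hii : ∀ u v : ℝ, 0 ≤ u → u ≤ v → IntervalIntegrable (fun y => Real.cos (c * y) / (a + y)) volume u v := by
      intro u v hu hv
      refine ContinuousOn.intervalIntegrable (ContinuousOn.div (by fun_prop) (by fun_prop) ?_)
      intro y hy
      rw [Set.uIcc_of_le hv] at hy
      linarith [hy.1]
    have h1 : ∫ y in (0 : ℝ)..1, digamma (a + (N + 1 : ℕ) + y) * Real.cos (c * y) =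
        (∫ y in (0 : ℝ)..1, digamma (a + N + y) * Real.cos (c * y)) +
        ∫ y in (0 : ℝ)..1, Real.cos (c * y) / (a + N + y) := by
      rw [← intervalIntegral.integral_add]
      · refine intervalIntegral.integral_congr fun y hy => ?_
        have := digamma_add_one (hpos y hy)
        have e : a + (N + 1 : ℕ) + y = a + N + y + 1 := by push_cast; ring
        rw [e, this]; ring
      · refine ContinuousOn.intervalIntegrable (ContinuousOn.mul ?_ (by fun_prop))
        exact digamma_cont.comp (by fun_prop) (fun y hy => hpos y hy)
      · refine ContinuousOn.intervalIntegrable (ContinuousOn.div (by fun_prop) (by fun_prop) ?_)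
        intro y hy
        exact (hpos y hy).ne'
    have h2 : ∫ y in (0 : ℝ)..1, Real.cos (c * y) / (a + N + y) =
        ∫ y in (N : ℝ)..(N + 1 : ℕ), Real.cos (c * y) / (a + y) := by
      have := intervalIntegral.integral_comp_add_right (a := 0) (b := 1)
        (fun y => Real.cos (c * y) / (a + y)) (N : ℝ)
      rw [zero_add, show (1 : ℝ) + N = (N + 1 : ℕ) by push_cast; ring] at this
      rw [← this]
      refine intervalIntegral.integral_congr fun y _ => ?_
      have e : c * (y + N) = c * y + ((k * N : ℕ) : ℝ) * (2 * π) := by rw [hck]; push_cast; ring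
      rw [e, Real.cos_add_nat_mul_two_pi]
      ring_nf
    have h3 := intervalIntegral.integral_add_adjacent_intervals (hii 0 N le_rfl hN)
      (hii N (N + 1 : ℕ) hN (by push_cast; linarith))
    rw [h1, h2, ← h3]
    ring

lemma coeff_cos {a c : ℝ} (ha : 0 < a) (k : ℕ) (hk : 0 < k) (hck : c = 2 * π * k) :
    ∫ y in (0 : ℝ)..1, digamma (a + y) * Real.cos (c * y) =
      - ∫ t in Set.Ioi (0 : ℝ), t * Real.exp (-c * t) / (t ^ 2 + a ^ 2) := by
  have hc : 0 < c := by rw [hck]; positivity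
  rw [← kernel_swap ha hc]
  set J := ∫ y in (0 : ℝ)..1, digamma (a + y) * Real.cos (c * y)
  set K := ∫ t in Set.Ioi (0 : ℝ), t * Real.exp (-a * t) / (t ^ 2 + c ^ 2) with hK
  have hcos0 : ∫ y in (0 : ℝ)..1, Real.cos (c * y) = 0 := by
    rw [intervalIntegral.integral_comp_mul_left (fun y => Real.cos y) hc.ne', integral_cos]
    have : Real.sin (c * 1) = 0 := by
      have := Real.sin_nat_mul_pi (2 * k)
      rw [← this, hck]; push_cast; ring_nf
    rw [this]; simp
  have key : ∀ N : ℕ, |J + K| ≤ 1 / (a + N) + 1 / ((a + N) ^ 2 * c ^ 2) := by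
    intro N
    have hN : (0 : ℝ) ≤ N := Nat.cast_nonneg N
    have haN : 0 < a + N := by linarith
    have h1 : ∫ y in (0 : ℝ)..N, Real.cos (c * y) / (a + y) =
        K - ∫ t in Set.Ioi (0 : ℝ), t * Real.exp (-(a + N) * t) / (t ^ 2 + c ^ 2) := by
      rw [integral_cos_div ha k N hck, hK, ← integral_sub (integrable_kernel hc ha)
        (integrable_kernel hc haN)]
      refine setIntegral_congr_fun measurableSet_Ioi fun t ht => ?_
      have e : Real.exp (-(a + N) * t) = Real.exp (-a * t) * Real.exp (-t * N) := by
        rw [← Real.exp_add]; ring_nf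
      rw [e]; ring
    have h2 := shift_identity ha k hck N
    have h3 := integral_kernel_le hc haN
    have h4 := integral_kernel_nonneg c (a + N)
    have hpos : ∀ y ∈ Set.uIcc (0 : ℝ) 1, 0 < a + N + y := by
      intro y hy
      rw [Set.uIcc_of_le zero_le_one] at hy
      linarith [hy.1]
    have h5 : ∫ y in (0 : ℝ)..1, digamma (a + N + y) * Real.cos (c * y) =
        ∫ y in (0 : ℝ)..1, (digamma (a + N + y) - digamma (a + N)) * Real.cos (c * y) := by
      simp only [sub_mul]
      rw [intervalIntegral.integral_sub, intervalIntegral.integral_const_mul, hcos0]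
      · simp
      · refine ContinuousOn.intervalIntegrable (ContinuousOn.mul ?_ (by fun_prop))
        exact digamma_cont.comp (by fun_prop) (fun y hy => hpos y hy)
      · exact Continuous.intervalIntegrable (by fun_prop) _ _
    have h6 : |∫ y in (0 : ℝ)..1, (digamma (a + N + y) - digamma (a + N)) * Real.cos (c * y)|
        ≤ 1 / (a + N) := by
      have := intervalIntegral.norm_integral_le_of_norm_le_const (a := 0) (b := 1)
        (f := fun y => (digamma (a + N + y) - digamma (a + N)) * Real.cos (c * y))
        (C := 1 / (a + N)) ?_
      · simpa using this
      · intro y hy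
        rw [Set.uIoc_of_le zero_le_one] at hy
        have m1 : digamma (a + N) ≤ digamma (a + N + y) :=
          digamma_mono haN (show 0 < a + N + y by linarith [hy.1]) (by linarith [hy.1])
        have m2 : digamma (a + N + y) ≤ digamma (a + N + 1) :=
          digamma_mono (show 0 < a + N + y by linarith [hy.1]) (show 0 < a + N + 1 by linarith)
            (by linarith [hy.2])
        rw [digamma_add_one haN] at m2
        rw [norm_mul, Real.norm_eq_abs, Real.norm_eq_abs, abs_of_nonneg (by linarith)]
        have h4 := Real.abs_cos_le_one (c * y)
        calc _ ≤ (digamma (a + N + y) - digamma (a + N)) * 1 := by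
              gcongr
          _ ≤ _ := by linarith
    rw [h5, h1] at h2
    rw [abs_le] at h6 ⊢
    have h2 : J = _ := h2
    constructor <;> linarith [h6.1, h6.2]
  have hlim : Filter.Tendsto (fun N : ℕ => 1 / (a + N) + 1 / ((a + N) ^ 2 * c ^ 2)) Filter.atTop
      (nhds (0 + 0)) := by
    have t0 : Filter.Tendsto (fun N : ℕ => a + (N : ℝ)) Filter.atTop Filter.atTop :=
      Filter.tendsto_atTop_add_const_left _ _ tendsto_natCast_atTop_atTop
    have t1 : Filter.Tendsto (fun N : ℕ => 1 / (a + (N : ℝ))) Filter.atTop (nhds 0) := by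
      simp only [one_div]; exact tendsto_inv_atTop_zero.comp t0
    refine t1.add ?_
    have := (t1.pow 2).mul_const (1 / c ^ 2)
    simp only [ne_eq, OfNat.ofNat_ne_zero, not_false_eq_true, zero_pow, zero_mul] at this
    refine this.congr fun N => ?_
    rw [div_pow, one_pow, div_mul_div_comm, one_mul]
  have := ge_of_tendsto' hlim key
  have h0 : J + K = 0 := abs_eq_zero.1 (le_antisymm (by linarith) (abs_nonneg _))
  linarith

/-- the kernel integrals -/
noncomputable def kerInt (a : ℝ) (n : ℕ) : ℝ :=
  ∫ t in Set.Ioi (0 : ℝ), t * Real.exp (-(2 * π * n) * t) / (t ^ 2 + a ^ 2)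

/-- the Fourier coefficients -/
noncomputable def cf (a : ℝ) (n : ℕ) : ℝ :=
  if n = 0 then 2 * Real.log a else -2 * kerInt a n

/-- the symmetrised digamma function -/
noncomputable def Phi (a y : ℝ) : ℝ := digamma (a + y) + digamma (a + 1 - y)

lemma Phi_cont {a : ℝ} (ha : 0 < a) : ContinuousOn (Phi a) (Set.Icc 0 1) := by
  refine ContinuousOn.add ?_ ?_
  · refine digamma_cont.comp (by fun_prop) (fun y hy => ?_)
    show 0 < a + y
    linarith [hy.1]
  · refine digamma_cont.comp (by fun_prop) (fun y hy => ?_)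
    show 0 < a + 1 - y
    linarith [hy.2]

lemma Phi_sin {a : ℝ} (n : ℕ) :
    ∫ y in (0 : ℝ)..1, Phi a y * Real.sin (2 * π * n * y) = 0 := by
  have h := intervalIntegral.integral_comp_sub_left (a := 0) (b := 1)
    (fun y => Phi a y * Real.sin (2 * π * n * y)) 1
  simp only [sub_self, sub_zero] at h
  have h2 : ∫ y in (0 : ℝ)..1, Phi a (1 - y) * Real.sin (2 * π * n * (1 - y)) =
      ∫ y in (0 : ℝ)..1, -(Phi a y * Real.sin (2 * π * n * y)) := by
    refine intervalIntegral.integral_congr fun y _ => ?_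
    have e : 2 * π * n * (1 - y) = n * (2 * π) - 2 * π * n * y := by ring
    have e1 : Phi a (1 - y) = Phi a y := by
      unfold Phi
      rw [add_comm]; ring_nf
    show Phi a (1 - y) * Real.sin (2 * π * n * (1 - y)) = -(Phi a y * Real.sin (2 * π * n * y))
    rw [e, e1, Real.sin_nat_mul_two_pi_sub]
    ring
  rw [h2, intervalIntegral.integral_neg] at h
  linarith

lemma Phi_cos {a : ℝ} (ha : 0 < a) (n : ℕ) :
    ∫ y in (0 : ℝ)..1, Phi a y * Real.cos (2 * π * n * y) = cf a n := by
  have h := intervalIntegral.integral_comp_sub_left (a := 0) (b := 1)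
    (fun y => digamma (a + y) * Real.cos (2 * π * n * y)) 1
  simp only [sub_self, sub_zero] at h
  have h2 : ∫ y in (0 : ℝ)..1, digamma (a + (1 - y)) * Real.cos (2 * π * n * (1 - y)) =
      ∫ y in (0 : ℝ)..1, digamma (a + 1 - y) * Real.cos (2 * π * n * y) := by
    refine intervalIntegral.integral_congr fun y _ => ?_
    have e : 2 * π * n * (1 - y) = n * (2 * π) - 2 * π * n * y := by ring
    show digamma (a + (1 - y)) * Real.cos (2 * π * n * (1 - y)) =
      digamma (a + 1 - y) * Real.cos (2 * π * n * y)
    rw [e, Real.cos_nat_mul_two_pi_sub, add_sub_assoc]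
  have h3 : ∫ y in (0 : ℝ)..1, Phi a y * Real.cos (2 * π * n * y) =
      2 * ∫ y in (0 : ℝ)..1, digamma (a + y) * Real.cos (2 * π * n * y) := by
    have i1 : IntervalIntegrable (fun y => digamma (a + y) * Real.cos (2 * π * n * y))
        volume 0 1 := by
      refine ContinuousOn.intervalIntegrable (ContinuousOn.mul ?_ (by fun_prop))
      refine digamma_cont.comp (by fun_prop) (fun y hy => ?_)
      rw [Set.uIcc_of_le zero_le_one] at hy
      show 0 < a + y
      linarith [hy.1]
    have i2 : IntervalIntegrable (fun y => digamma (a + 1 - y) * Real.cos (2 * π * n * y))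
        volume 0 1 := by
      refine ContinuousOn.intervalIntegrable (ContinuousOn.mul ?_ (by fun_prop))
      refine digamma_cont.comp (by fun_prop) (fun y hy => ?_)
      rw [Set.uIcc_of_le zero_le_one] at hy
      show 0 < a + 1 - y
      linarith [hy.2]
    simp only [Phi, add_mul]
    rw [intervalIntegral.integral_add i1 i2, ← h2, h]
    exact (two_mul _).symm
  rw [h3, cf]
  split_ifs with h0
  · subst h0
    simp [integral_digamma ha]
  · rw [coeff_cos ha n (Nat.pos_of_ne_zero h0) rfl, kerInt]
    ring

lemma summable_kerInt {a : ℝ} (ha : 0 < a) : Summable (fun n : ℕ => kerInt a (n + 1)) := by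
  have hs : Summable (fun n : ℕ => 1 / a ^ 2 * (1 / ((n + 1 : ℕ) : ℝ) ^ 2)) :=
    ((summable_nat_add_iff 1).2 (Real.summable_one_div_nat_pow.2 (by norm_num : 1 < 2))).mul_left _
  refine Summable.of_nonneg_of_le (fun n => integral_kernel_nonneg _ _) (fun n => ?_) hs
  have hn : (0 : ℝ) < ((n + 1 : ℕ) : ℝ) := by positivity
  refine (integral_kernel_le ha (b := 2 * π * ((n + 1 : ℕ) : ℝ)) (by positivity)).trans ?_
  rw [div_mul_div_comm, one_mul]
  have h1 : 1 ≤ (2 * π) ^ 2 := by nlinarith [Real.pi_gt_three]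
  refine one_div_le_one_div_of_le (by positivity) ?_
  rw [mul_pow]
  nlinarith [mul_pos (pow_pos ha 2) (pow_pos hn 2)]

lemma summable_cf {a : ℝ} (ha : 0 < a) : Summable (cf a) := by
  refine (summable_nat_add_iff 1).1 ?_
  have : (fun n : ℕ => cf a (n + 1)) = fun n : ℕ => -2 * kerInt a (n + 1) := by
    funext n; simp [cf]
  rw [this]
  exact (summable_kerInt ha).mul_left _

lemma natAbs_eq (n : ℤ) : (n : ℝ) = n.natAbs ∨ (n : ℝ) = -(n.natAbs : ℝ) := by
  rcases Int.natAbs_eq n with h | h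
  · left; rw [← Int.cast_natCast, ← h]
  · right; rw [← Int.cast_natCast, ← Int.cast_neg, ← h]

lemma fc {a : ℝ} (ha : 0 < a) (n : ℤ) :
    fourierCoeff (AddCircle.liftIco 1 0 (fun y : ℝ => (Phi a y : ℂ))) n = (cf a n.natAbs : ℂ) := by
  rw [fourierCoeff_liftIco_eq, fourierCoeffOn_eq_integral]
  have hI : ∀ g : ℝ → ℝ, Continuous g → IntervalIntegrable (fun y => Phi a y * g y) volume 0 1 := by
    intro g hg
    refine ContinuousOn.intervalIntegrable ?_
    rw [Set.uIcc_of_le zero_le_one]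
    exact (Phi_cont ha).mul hg.continuousOn
  have hc : ∫ y in (0 : ℝ)..1, Phi a y * Real.cos (2 * π * n * y) = cf a n.natAbs := by
    rw [← Phi_cos ha]
    rcases natAbs_eq n with h | h
    · rw [h]
    · rw [h]
      simp
  have hs : ∫ y in (0 : ℝ)..1, Phi a y * Real.sin (2 * π * n * y) = 0 := by
    rcases natAbs_eq n with h | h
    · rw [h]; exact Phi_sin _
    · rw [h]
      have := Phi_sin (a := a) n.natAbs
      simp only [mul_neg, neg_mul, Real.sin_neg, intervalIntegral.integral_neg, this, neg_zero]
  have e : ∀ y : ℝ, (fourier (-n) (y : AddCircle ((0 : ℝ) + 1 - 0)) : ℂ) • (Phi a y : ℂ) =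
      ((Phi a y * Real.cos (2 * π * n * y) : ℝ) : ℂ) -
        ((Phi a y * Real.sin (2 * π * n * y) : ℝ) : ℂ) * Complex.I := by
    intro y
    rw [fourier_coe_apply]
    have e2 : (2 * π * Complex.I * ((-n : ℤ) : ℂ) * y / ((0 + 1 - 0 : ℝ) : ℂ) : ℂ) =
      ((-(2 * π * n * y) : ℝ) : ℂ) * Complex.I := by
      push_cast; ring
    rw [e2, Complex.exp_mul_I, ← Complex.ofReal_cos, ← Complex.ofReal_sin, Real.cos_neg,
      Real.sin_neg]
    push_cast
    rw [smul_eq_mul]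
    ring
  simp only [e, zero_add]
  rw [intervalIntegral.integral_sub, intervalIntegral.integral_mul_const,
    intervalIntegral.integral_ofReal, intervalIntegral.integral_ofReal, hc, hs]
  · simp
  · have := hI (fun y => Real.cos (2 * π * n * y)) (by fun_prop)
    exact ⟨this.1.ofReal, this.2.ofReal⟩
  · have := hI (fun y => Real.sin (2 * π * n * y)) (by fun_prop)
    have h2 : IntervalIntegrable
      (fun y => ((Phi a y * Real.sin (2 * π * n * y) : ℝ) : ℂ)) volume 0 1 :=
      ⟨this.1.ofReal, this.2.ofReal⟩
    exact h2.mul_const _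

lemma Phi_hasSum {a y : ℝ} (ha : 0 < a) (hy0 : 0 ≤ y) (hy1 : y < 1) :
    HasSum (fun n : ℕ => -4 * kerInt a (n + 1) * Real.cos (2 * π * (n + 1 : ℕ) * y))
      (Phi a y - 2 * Real.log a) := by
  have hcont : Continuous (AddCircle.liftIco 1 0 (fun y : ℝ => (Phi a y : ℂ))) := by
    refine AddCircle.liftIco_zero_continuous ?_ ?_
    · unfold Phi; simp [add_comm]
    · exact Complex.continuous_ofReal.comp_continuousOn (Phi_cont ha)
  let F : C(AddCircle (1 : ℝ), ℂ) := ⟨_, hcont⟩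
  have hF : ∀ n, fourierCoeff F n = (cf a n.natAbs : ℂ) := fc ha
  have hsum : Summable (fourierCoeff F) := by
    have : fourierCoeff F = fun n : ℤ => (cf a n.natAbs : ℂ) := funext hF
    rw [this]
    have h1 : Summable (fun n : ℕ => (cf a n : ℂ)) := by exact_mod_cast summable_cf ha
    refine Summable.of_nat_of_neg ?_ ?_
    · simpa using h1
    · simpa using h1
  have h := has_pointwise_sum_fourier_series_of_summable hsum (y : AddCircle (1 : ℝ))
  have hFy : F (y : AddCircle (1 : ℝ)) = (Phi a y : ℂ) :=
    AddCircle.liftIco_zero_coe_apply (f := fun y : ℝ => (Phi a y : ℂ)) ⟨hy0, hy1⟩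
  rw [hFy] at h
  have h2 := h.nat_add_neg
  have h3 : HasSum (fun n : ℕ => ((2 * cf a n * Real.cos (2 * π * n * y) : ℝ) : ℂ))
      ((Phi a y + 2 * Real.log a : ℝ) : ℂ) := by
    convert h2 using 1
    · funext n
      rw [hF, hF, fourier_coe_apply, fourier_coe_apply]
      have e1 : (2 * π * Complex.I * ((n : ℤ) : ℂ) * y / ((1 : ℝ) : ℂ) : ℂ) =
        ((2 * π * n * y : ℝ) : ℂ) * Complex.I := by push_cast; ring
      have e2 : (2 * π * Complex.I * ((-(n : ℤ) : ℤ) : ℂ) * y / ((1 : ℝ) : ℂ) : ℂ) =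
        ((-(2 * π * n * y) : ℝ) : ℂ) * Complex.I := by push_cast; ring
      rw [e1, e2, Complex.exp_mul_I, Complex.exp_mul_I, ← Complex.ofReal_cos, ← Complex.ofReal_sin,
        ← Complex.ofReal_cos, ← Complex.ofReal_sin, Real.cos_neg, Real.sin_neg]
      simp only [Int.natAbs_neg, Int.natAbs_natCast, smul_eq_mul]
      push_cast
      ring
    · rw [hF]
      simp [cf]
  have h4 : HasSum (fun n : ℕ => 2 * cf a n * Real.cos (2 * π * n * y))
      (Phi a y + 2 * Real.log a) := by exact_mod_cast h3
  have h5 := (hasSum_nat_add_iff' 1).2 h4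
  have e1 : (fun n : ℕ => -4 * kerInt a (n + 1) * Real.cos (2 * π * (n + 1 : ℕ) * y)) =
      fun n : ℕ => 2 * cf a (n + 1) * Real.cos (2 * π * (n + 1 : ℕ) * y) := by
    funext n
    have : cf a (n + 1) = -2 * kerInt a (n + 1) := by simp [cf]
    rw [this]
    ring
  have e2 : Phi a y - 2 * Real.log a = Phi a y + 2 * Real.log a -
      ∑ i ∈ Finset.range 1, 2 * cf a i * Real.cos (2 * π * i * y) := by
    simp [cf]
    ring
  rw [e1, e2]
  exact h5

lemma aux_re (A B : ℝ) : ((A : ℂ) + (B : ℂ) * Complex.I).re = A := by simp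

lemma fId_hasSum {m l : ℝ} (hl : 0 < l) :
    HasSum (fun n : ℕ => -4 * Real.exp (-(2 * π * (n + 1 : ℕ)) * l) *
      Real.cos (2 * π * (n + 1 : ℕ) * (1 / 2 + m / 2))) (fId m l) := by
  set q : ℂ := Complex.exp (((-(2 * π * l) : ℝ) : ℂ) + ((π + π * m : ℝ) : ℂ) * Complex.I) with hq
  have hqn : ‖q‖ < 1 := by
    rw [hq, Complex.norm_exp]
    have : (((-(2 * π * l) : ℝ) : ℂ) + ((π + π * m : ℝ) : ℂ) * Complex.I).re = -(2 * π * l) := by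
      simp
    rw [this, Real.exp_lt_one_iff]
    have := Real.pi_pos
    have : 0 < 2 * π * l := by positivity
    linarith
  have h1 := ((hasSum_geometric_of_norm_lt_one hqn).mul_left (-4 * q))
  have h2 := Complex.hasSum_re h1
  convert h2 using 1
  · funext n
    have e : -4 * q * q ^ n = -4 * q ^ (n + 1) := by ring
    have e2 : q ^ (n + 1) = Complex.exp (((-(2 * π * (n + 1 : ℕ)) * l : ℝ) : ℂ) +
        ((2 * π * (n + 1 : ℕ) * (1 / 2 + m / 2) : ℝ) : ℂ) * Complex.I) := by
      rw [hq, ← Complex.exp_nat_mul]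
      congr 1
      push_cast; ring
    rw [e, e2, Complex.exp_add, ← Complex.ofReal_exp, Complex.exp_mul_I, ← Complex.ofReal_cos,
      ← Complex.ofReal_sin]
    generalize Real.exp (-(2 * π * (n + 1 : ℕ)) * l) = E
    generalize Real.cos (2 * π * (n + 1 : ℕ) * (1 / 2 + m / 2)) = A
    generalize Real.sin (2 * π * (n + 1 : ℕ) * (1 / 2 + m / 2)) = B
    rw [← aux_re (-4 * E * A) (-4 * E * B)]
    congr 1
    push_cast
    ring
  · have e3 : q = -((Real.exp (-(2 * π * l)) : ℝ) : ℂ) *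
        ((Real.cos (π * m) : ℂ) + (Real.sin (π * m) : ℂ) * Complex.I) := by
      rw [hq, Complex.exp_add, ← Complex.ofReal_exp, Complex.exp_mul_I, ← Complex.ofReal_cos,
        ← Complex.ofReal_sin, add_comm π, Real.cos_add_pi, Real.sin_add_pi]
      push_cast
      ring
    have hE : Real.exp (2 * π * l) = (Real.exp (-(2 * π * l)))⁻¹ := by
      rw [Real.exp_neg, inv_inv]
    have hE4 : Real.exp (4 * π * l) = (Real.exp (-(2 * π * l)))⁻¹ ^ 2 := by
      rw [← hE, sq, ← Real.exp_add]; ring_nf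
    unfold fId
    rw [hE, hE4]
    have hx1 : Real.exp (-(2 * π * l)) < 1 := by
      rw [Real.exp_lt_one_iff]
      have : 0 < 2 * π * l := by positivity
      linarith
    have hx0 := Real.exp_pos (-(2 * π * l))
    set x := Real.exp (-(2 * π * l))
    have hcs := Real.sin_sq_add_cos_sq (π * m)
    have hcl := Real.neg_one_le_cos (π * m)
    set C := Real.cos (π * m)
    set S := Real.sin (π * m)
    have hD : 0 < 1 + 2 * x * C + x ^ 2 := by nlinarith [sq_pos_of_pos (sub_pos.2 hx1)]
    obtain ⟨D, hDd⟩ : ∃ D, D = 1 + 2 * x * C + x ^ 2 := ⟨_, rfl⟩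
    rw [← hDd] at hD
    have hDne := hD.ne'
    have e4 : (1 - q) = ((1 + x * C : ℝ) : ℂ) + ((x * S : ℝ) : ℂ) * Complex.I := by
      rw [e3]; push_cast; ring
    have e5 : (1 - q)⁻¹ = (((1 + x * C) / D : ℝ) : ℂ) -
        ((x * S / D : ℝ) : ℂ) * Complex.I := by
      refine (eq_inv_of_mul_eq_one_left ?_).symm
      have hP : (1 + x * C) / D * (1 + x * C) +
          x * S / D * (x * S) = 1 := by
        field_simp
        linear_combination x ^ 2 * hcs - hDd
      have hQ : (1 + x * C) / D * (x * S) -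
          x * S / D * (1 + x * C) = 0 := by
        ring
      rw [e4]
      generalize (1 + x * C) / D = P at *
      generalize x * S / D = Q at *
      generalize (1 + x * C) = U at *
      generalize x * S = V at *
      have hP' : (P : ℂ) * U + Q * V = 1 := by exact_mod_cast hP
      have hQ' : (P : ℂ) * V - Q * U = 0 := by exact_mod_cast hQ
      linear_combination hP' + Complex.I * hQ' - Q * V * Complex.I_sq
    have e6 : -4 * q * (1 - q)⁻¹ =
        ((4 * x * (C * ((1 + x * C) / D) +
          S * (x * S / D)) : ℝ) : ℂ) +
        ((4 * x * (S * ((1 + x * C) / D) -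
          C * (x * S / D)) : ℝ) : ℂ) * Complex.I := by
      rw [e5, e3]
      generalize (1 + x * C) / D = P
      generalize x * S / D = Q
      push_cast
      linear_combination (-4 * x * S * Q : ℂ) * Complex.I_sq
    rw [e6, aux_re]
    have hD2 : x⁻¹ ^ 2 + 2 * x⁻¹ * C + 1 = D / x ^ 2 := by
      rw [hDd]
      field_simp
    rw [hD2]
    field_simp
    linear_combination (-x) * hcs

theorem stmt_8 (s m : ℝ) (hs : 1 < s) (hm1 : -1 < m) (hm2 : m < 1) :
    Real.log ((s - 1 / 2) ^ 2) +
      ∫ lam in Set.Ioi (0 : ℝ), lam * fId m lam / (lam ^ 2 + (s - 1 / 2) ^ 2)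
    = digamma (s + m / 2) + digamma (s - m / 2) := by
  have ha : 0 < s - 1 / 2 := by linarith
  set a := s - 1 / 2 with has
  set y := 1 / 2 + m / 2 with hy
  have hP := Phi_hasSum ha (show 0 ≤ y by linarith) (show y < 1 by linarith)
  have hPhi : Phi a y = digamma (s + m / 2) + digamma (s - m / 2) := by
    unfold Phi
    rw [has, hy]
    ring_nf
  let F : ℕ → ℝ → ℝ := fun n t => (-4 * Real.cos (2 * π * (n + 1 : ℕ) * y)) *
    (t * Real.exp (-(2 * π * (n + 1 : ℕ)) * t) / (t ^ 2 + a ^ 2))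
  have hFi : ∀ n, IntegrableOn (F n) (Set.Ioi 0) := fun n =>
    (integrable_kernel ha (b := 2 * π * (n + 1 : ℕ)) (by positivity)).const_mul _
  have hFint : ∀ n, ∫ t in Set.Ioi (0 : ℝ), F n t =
      -4 * kerInt a (n + 1) * Real.cos (2 * π * (n + 1 : ℕ) * y) := by
    intro n
    simp only [F]
    rw [integral_const_mul, kerInt]
    ring
  have hFn : Summable fun n => ∫ t in Set.Ioi (0 : ℝ), ‖F n t‖ := by
    refine Summable.of_nonneg_of_le (fun n => integral_nonneg fun t => norm_nonneg _) (fun n => ?_)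
      ((summable_kerInt ha).mul_left 4)
    rw [kerInt, ← integral_const_mul]
    refine setIntegral_mono_on (hFi n).norm
      ((integrable_kernel ha (b := 2 * π * (n + 1 : ℕ)) (by positivity)).const_mul _)
      measurableSet_Ioi fun t ht => ?_
    have ht : 0 < t := ht
    simp only [F]
    rw [norm_mul, Real.norm_of_nonneg (by positivity :
      0 ≤ t * Real.exp (-(2 * π * (n + 1 : ℕ)) * t) / (t ^ 2 + a ^ 2))]
    have hc : ‖-4 * Real.cos (2 * π * (n + 1 : ℕ) * y)‖ ≤ 4 := by
      have := Real.abs_cos_le_one (2 * π * (n + 1 : ℕ) * y)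
      rw [Real.norm_eq_abs, abs_mul, abs_neg, abs_of_pos (by norm_num : (0 : ℝ) < 4)]
      linarith
    exact mul_le_mul_of_nonneg_right hc (by positivity)
  have hH := hasSum_integral_of_summable_integral_norm hFi hFn
  simp only [hFint] at hH
  have hEq := hH.unique hP
  have hI : ∫ lam in Set.Ioi (0 : ℝ), lam * fId m lam / (lam ^ 2 + a ^ 2) =
      ∫ t in Set.Ioi (0 : ℝ), ∑' n, F n t := by
    refine setIntegral_congr_fun measurableSet_Ioi fun t ht => ?_
    have h := ((fId_hasSum (m := m) (show 0 < t from ht)).mul_left (t / (t ^ 2 + a ^ 2))).tsum_eq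
    show t * fId m t / (t ^ 2 + a ^ 2) = ∑' n, F n t
    rw [mul_div_right_comm, ← h]
    refine tsum_congr fun n => ?_
    simp only [F]
    ring
  rw [hI, hEq, hPhi, Real.log_pow]
  push_cast
  ring
end

section
/- As real s → ∞, log G(s+1) = (s²/2)(log s − 3/2) − (log s)/12 − s ζ'(0) + ζ'(−1) + O(s^{−2}), where G is the Barnes double Gamma function and ζ is the Riemann zeta function. -/
open Complex Real Filter Asymptotics

/-- The Barnes double Gamma function (shifted): `BarnesG s = G(s)`, defined via
`G(s+1) = (2π)^{s/2} exp(-((1+γ)s²+s)/2) ∏_{n=1}^∞ (1+s/n)^n exp(-s+s²/(2n))`. -/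
noncomputable def BarnesG (s : ℂ) : ℂ :=
  (2 * (π : ℂ)) ^ ((s - 1) / 2) *
    Complex.exp (-(((1 + (Real.eulerMascheroniConstant : ℂ)) * (s - 1) ^ 2 + (s - 1)) / 2)) *
    ∏' n : ℕ, (1 + (s - 1) / (n + 1)) ^ (n + 1) *
      Complex.exp (-(s - 1) + (s - 1) ^ 2 / (2 * (n + 1)))


noncomputable def bgU (x : ℝ) : ℝ :=
  x ^ 2 / 2 * Real.log x - x ^ 2 / 4 + x / 2 * Real.log x + Real.log x / 12 + 1 / 12

noncomputable def bgV (x : ℝ) : ℝ :=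
  x * Real.log x - x + Real.log x / 2 + 1 / (12 * x)

noncomputable def bgE (x : ℝ) : ℝ := (x + 1) * Real.log (x + 1) - (bgU (x + 1) - bgU x)

noncomputable def bgL (x : ℝ) : ℝ := Real.log (x + 1) - (bgV (x + 1) - bgV x)

noncomputable def bgT (s : ℝ) (k : ℕ) : ℝ :=
  ((k : ℝ) + 1) * Real.log (1 + s / ((k : ℝ) + 1)) + (-s + s ^ 2 / (2 * ((k : ℝ) + 1)))

lemma bg_log4 {u : ℝ} (h0 : 0 ≤ u) (h1 : u ≤ 1 / 2) :
    |Real.log (1 + u) - (u - u ^ 2 / 2 + u ^ 3 / 3 - u ^ 4 / 4)| ≤ 2 * u ^ 5 := by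
  have h := Real.abs_log_sub_add_sum_range_le (x := -u) (by rw [abs_neg, abs_of_nonneg h0]; linarith) 4
  rw [abs_neg, abs_of_nonneg h0] at h
  simp only [Finset.sum_range_succ, Finset.sum_range_zero, sub_neg_eq_add] at h
  norm_num at h
  have h2 : u ^ 5 / (1 - u) ≤ 2 * u ^ 5 := by
    rw [div_le_iff₀ (by linarith)]
    nlinarith [pow_nonneg h0 5]
  refine le_trans (le_of_eq ?_) (h.trans h2)
  congr 1; ring

lemma bg_log2 {u : ℝ} (h0 : 0 ≤ u) (h1 : u ≤ 1 / 2) :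
    |Real.log (1 + u) - (u - u ^ 2 / 2)| ≤ 2 * u ^ 3 := by
  have h := Real.abs_log_sub_add_sum_range_le (x := -u) (by rw [abs_neg, abs_of_nonneg h0]; linarith) 2
  rw [abs_neg, abs_of_nonneg h0] at h
  simp only [Finset.sum_range_succ, Finset.sum_range_zero, sub_neg_eq_add] at h
  norm_num at h
  have h2 : u ^ 3 / (1 - u) ≤ 2 * u ^ 3 := by
    rw [div_le_iff₀ (by linarith)]
    nlinarith [pow_nonneg h0 3]
  refine le_trans (le_of_eq ?_) (h.trans h2)
  congr 1; ring

lemma bg_log_succ {x : ℝ} (hx : 0 < x) :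
    Real.log (x + 1) = Real.log x + Real.log (1 + 1 / x) := by
  rw [← Real.log_mul hx.ne' (by positivity)]
  congr 1; field_simp

lemma bgE_bound {x : ℝ} (hx : 2 ≤ x) : |bgE x| ≤ 4 / x ^ 3 := by
  have hx0 : 0 < x := by linarith
  obtain ⟨u, hu⟩ : ∃ u, u = 1 / x := ⟨_, rfl⟩
  have hu0 : 0 < u := by rw [hu]; positivity
  have hu1 : u ≤ 1 / 2 := by rw [hu]; exact one_div_le_one_div_of_le (by norm_num) hx
  have hxu : x * u = 1 := by rw [hu]; field_simp
  have hl := bg_log4 hu0.le hu1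
  set d := Real.log (1 + u) - (u - u ^ 2 / 2 + u ^ 3 / 3 - u ^ 4 / 4) with hd
  have key : bgE x = -(x ^ 2 / 2 + x / 2 + 1 / 12) * d + u ^ 3 * (1 / 8 - 1 / 36 + u / 48) := by
    have e1 : Real.log (1 + u) = d + (u - u ^ 2 / 2 + u ^ 3 / 3 - u ^ 4 / 4) := by rw [hd]; ring
    unfold bgE bgU
    rw [bg_log_succ hx0, ← hu, e1]
    have hx' : x = 1 / u := by rw [hu]; field_simp
    rw [hx']
    field_simp
    ring
  have h4 : 4 / x ^ 3 = 4 * u ^ 3 := by rw [hu]; field_simp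
  rw [key, h4]
  have hA : (x ^ 2 / 2 + x / 2 + 1 / 12) * (2 * u ^ 5) = u ^ 3 * (1 + u + u ^ 2 / 6) := by
    have hx' : x = 1 / u := by rw [hu]; field_simp
    rw [hx']; field_simp; ring
  have h3 : |(x ^ 2 / 2 + x / 2 + 1 / 12) * d| ≤ u ^ 3 * (1 + u + u ^ 2 / 6) := by
    rw [abs_mul, abs_of_pos (by positivity), ← hA]
    gcongr
  have h5 : |u ^ 3 * (1 / 8 - 1 / 36 + u / 48)| ≤ u ^ 3 * 1 := by
    rw [abs_mul, abs_of_pos (by positivity : 0 < u ^ 3)]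
    gcongr
    rw [abs_le]; constructor <;> linarith
  have h6 : u ^ 3 * (1 + u + u ^ 2 / 6) ≤ u ^ 3 * 3 := by
    gcongr; nlinarith
  calc _ ≤ |-(x ^ 2 / 2 + x / 2 + 1 / 12) * d| + |u ^ 3 * (1 / 8 - 1 / 36 + u / 48)| := abs_add_le _ _
    _ ≤ _ := by rw [neg_mul, abs_neg]; linarith

lemma bgL_bound {x : ℝ} (hx : 2 ≤ x) : |bgL x| ≤ 4 / x ^ 4 := by
  have hx0 : 0 < x := by linarith
  obtain ⟨u, hu⟩ : ∃ u, u = 1 / x := ⟨_, rfl⟩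
  have hu0 : 0 < u := by rw [hu]; positivity
  have hu1 : u ≤ 1 / 2 := by rw [hu]; exact one_div_le_one_div_of_le (by norm_num) hx
  have hl := bg_log4 hu0.le hu1
  set d := Real.log (1 + u) - (u - u ^ 2 / 2 + u ^ 3 / 3 - u ^ 4 / 4) with hd
  have hx' : x = 1 / u := by rw [hu]; field_simp
  have key : bgL x = -(x + 1 / 2) * d + u ^ 4 * (1 / 8 + 1 / (12 * (1 + u))) := by
    have e1 : Real.log (1 + u) = d + (u - u ^ 2 / 2 + u ^ 3 / 3 - u ^ 4 / 4) := by rw [hd]; ring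
    unfold bgL bgV
    rw [bg_log_succ hx0, ← hu, e1]
    rw [hx']
    field_simp
    ring
  have h4 : 4 / x ^ 4 = 4 * u ^ 4 := by rw [hu]; field_simp
  rw [key, h4]
  have hA : (x + 1 / 2) * (2 * u ^ 5) = u ^ 4 * (2 + u) := by
    rw [hx']; field_simp
  have h3 : |(x + 1 / 2) * d| ≤ u ^ 4 * (2 + u) := by
    rw [abs_mul, abs_of_pos (by positivity), ← hA]
    gcongr
  have h5 : |u ^ 4 * (1 / 8 + 1 / (12 * (1 + u)))| ≤ u ^ 4 * 1 := by
    rw [abs_of_pos (by positivity)]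
    gcongr
    have : 1 / (12 * (1 + u)) ≤ 1 / 12 := one_div_le_one_div_of_le (by norm_num) (by linarith)
    linarith
  have h6 : u ^ 4 * (2 + u) ≤ u ^ 4 * 3 := by
    gcongr; linarith
  calc _ ≤ |-(x + 1 / 2) * d| + |u ^ 4 * (1 / 8 + 1 / (12 * (1 + u)))| := abs_add_le _ _
    _ ≤ _ := by rw [neg_mul, abs_neg]; linarith

lemma bg_r_bound {s x : ℝ} (hs : 2 ≤ s) (hx : s ≤ x) : |bgE x - s * bgL x| ≤ 8 / x ^ 3 := by
  have h1 := bgE_bound (hs.trans hx)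
  have h2 := bgL_bound (hs.trans hx)
  have hx0 : 0 < x := by linarith
  have h3 : |s * bgL x| ≤ 4 / x ^ 3 := by
    rw [abs_mul, abs_of_pos (by linarith)]
    calc s * |bgL x| ≤ x * (4 / x ^ 4) := by gcongr
      _ = 4 / x ^ 3 := by field_simp
  calc _ ≤ |bgE x| + |s * bgL x| := abs_sub _ _
    _ ≤ 4 / x ^ 3 + 4 / x ^ 3 := by linarith
    _ = _ := by ring

lemma bg_R_bound {s : ℝ} (hs : 2 ≤ s) (N : ℕ) :
    |∑ k ∈ Finset.range N, (bgE (s + k) - s * bgL (s + k))| ≤ 16 / s ^ 2 := by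
  have key : |∑ k ∈ Finset.range N, (bgE (s + k) - s * bgL (s + k))| ≤
      16 / s ^ 2 - 16 / (s + N) ^ 2 := by
    induction N with
    | zero => simp
    | succ n ih =>
      rw [Finset.sum_range_succ]
      have hn : (0 : ℝ) ≤ n := Nat.cast_nonneg n
      have h1 := bg_r_bound hs (x := s + n) (by linarith)
      have h2 : 8 / (s + n) ^ 3 ≤ 16 / (s + n) ^ 2 - 16 / (s + (n + 1 : ℕ)) ^ 2 := by
        push_cast
        obtain ⟨x, hx⟩ : ∃ x, x = s + n := ⟨_, rfl⟩
        have hx2 : 2 ≤ x := by linarith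
        rw [show s + ((n : ℝ) + 1) = x + 1 by rw [hx]; ring, ← hx]
        rw [div_sub_div _ _ (by positivity) (by positivity), div_le_div_iff₀ (by positivity) (by positivity)]
        have : 0 ≤ x ^ 2 * (3 * x ^ 2 - 1) * 8 := by
          have : 0 ≤ 3 * x ^ 2 - 1 := by nlinarith
          positivity
        nlinarith [pow_pos (by linarith : 0 < x) 3, pow_pos (by linarith : 0 < x) 2]
      calc _ ≤ _ := abs_add_le _ _
        _ ≤ _ := add_le_add ih (h1.trans h2)
        _ = _ := by ring
  refine key.trans ?_
  have : 0 ≤ 16 / (s + N) ^ 2 := by positivity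
  linarith

lemma bg_sum_id {s : ℝ} (N : ℕ) :
    ∑ k ∈ Finset.range N, ((k : ℝ) + 1) * Real.log (s + k + 1) =
      bgU (s + N) - bgU s - s * (bgV (s + N) - bgV s) +
        ∑ k ∈ Finset.range N, (bgE (s + k) - s * bgL (s + k)) := by
  induction N with
  | zero => simp
  | succ n ih =>
    rw [Finset.sum_range_succ, Finset.sum_range_succ, ih]
    push_cast
    unfold bgE bgL
    rw [show s + ((n : ℝ) + 1) = s + n + 1 by ring]
    ring

noncomputable def bgA (N : ℕ) : ℝ :=
  ∑ k ∈ Finset.range N, ((k : ℝ) + 1) * Real.log (k + 1) - bgU N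

noncomputable def bgB (s : ℝ) (N : ℕ) : ℝ :=
  bgU (s + N) - bgU N - s * bgV (s + N) + s ^ 2 / 2 * Real.log N - N * s

lemma bg_S_id {s : ℝ} (hs : 0 < s) (N : ℕ) :
    ∑ k ∈ Finset.range N, bgT s k =
      bgB s N + (s * bgV s - bgU s) - bgA N + s ^ 2 / 2 * ((harmonic N : ℝ) - Real.log N) +
        ∑ k ∈ Finset.range N, (bgE (s + k) - s * bgL (s + k)) := by
  have h1 : ∑ k ∈ Finset.range N, bgT s k =
      ∑ k ∈ Finset.range N, ((k : ℝ) + 1) * Real.log (s + k + 1) -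
      ∑ k ∈ Finset.range N, ((k : ℝ) + 1) * Real.log (k + 1) - N * s + s ^ 2 / 2 * (harmonic N : ℝ) := by
    induction N with
    | zero => simp
    | succ n ih =>
      rw [Finset.sum_range_succ, Finset.sum_range_succ, Finset.sum_range_succ, ih, harmonic_succ]
      unfold bgT
      have : 1 + s / ((n : ℝ) + 1) = (s + n + 1) / (n + 1) := by field_simp; ring
      rw [this, Real.log_div (by positivity) (by positivity)]
      push_cast
      field_simp
      ring
  rw [h1, bg_sum_id]
  unfold bgA bgB
  ring

lemma bgB_tendsto {s : ℝ} (hs : 0 < s) :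
    Tendsto (fun N : ℕ => bgB s N) atTop (nhds (s / 2 + s ^ 2 / 2)) := by
  have hN : Tendsto (fun N : ℕ => (1 : ℝ) / N) atTop (nhds 0) := tendsto_one_div_atTop_nhds_zero_nat
  let d : ℕ → ℝ := fun N => Real.log (1 + s * (1 / N)) - (s * (1 / N) - (s * (1 / N)) ^ 2 / 2)
  have hsN : ∀ᶠ N : ℕ in atTop, s * (1 / N) ≤ 1 / 2 := by
    have : Tendsto (fun N : ℕ => s * ((1 : ℝ) / N)) atTop (nhds 0) := by simpa using hN.const_mul s
    exact (this.eventually (gt_mem_nhds (by norm_num : (0:ℝ) < 1 / 2))).mono fun _ h => h.le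
  have hd2 : Tendsto (fun N : ℕ => (N : ℝ) ^ 2 * d N) atTop (nhds 0) := by
    have hb : Tendsto (fun N : ℕ => 2 * s ^ 3 * ((1 : ℝ) / N)) atTop (nhds 0) := by
      simpa using hN.const_mul (2 * s ^ 3)
    refine squeeze_zero_norm' ?_ hb
    filter_upwards [hsN, eventually_gt_atTop 0] with N h1 h2
    have h2' : (0 : ℝ) < N := by exact_mod_cast h2
    have := bg_log2 (u := s * (1 / N)) (by positivity) h1
    rw [norm_mul, Real.norm_eq_abs, Real.norm_eq_abs, abs_of_pos (by positivity)]
    calc (N : ℝ) ^ 2 * |d N| ≤ N ^ 2 * (2 * (s * (1 / N)) ^ 3) := by gcongr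
      _ = _ := by field_simp
  have hd1 : Tendsto (fun N : ℕ => (N : ℝ) * d N) atTop (nhds 0) := by
    have := hd2.mul hN
    rw [zero_mul] at this
    refine this.congr' ?_
    filter_upwards [eventually_gt_atTop 0] with N h2
    have h2' : (0 : ℝ) < N := by exact_mod_cast h2
    field_simp
  have hl : Tendsto (fun N : ℕ => Real.log (1 + s * (1 / N))) atTop (nhds 0) := by
    have : Tendsto (fun N : ℕ => 1 + s * ((1 : ℝ) / N)) atTop (nhds 1) := by
      simpa using (hN.const_mul s).const_add 1
    have := (Real.continuousAt_log one_ne_zero).tendsto.comp this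
    rw [Real.log_one] at this
    exact this
  have hi : Tendsto (fun N : ℕ => 1 / (s + (N : ℝ))) atTop (nhds 0) := by
    have : Tendsto (fun N : ℕ => s + (N : ℝ)) atTop atTop :=
      tendsto_atTop_add_const_left _ _ tendsto_natCast_atTop_atTop
    simp only [one_div]
    exact this.inv_tendsto_atTop
  have main : Tendsto (fun N : ℕ => (N : ℝ) ^ 2 * d N / 2 + (N : ℝ) * d N / 2
      + (1 / 12 - s ^ 2 / 2) * Real.log (1 + s * (1 / N)) - s / 12 * (1 / (s + (N : ℝ)))
      - s ^ 2 / 4 * (1 / N) + (s / 2 + s ^ 2 / 2)) atTop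
      (nhds (0 / 2 + 0 / 2 + (1 / 12 - s ^ 2 / 2) * 0 - s / 12 * 0 - s ^ 2 / 4 * 0
        + (s / 2 + s ^ 2 / 2))) :=
    (((((hd2.div_const 2).add (hd1.div_const 2)).add (hl.const_mul _)).sub (hi.const_mul _)).sub
      (hN.const_mul _)).add_const _
  have h0 : (0 / 2 + 0 / 2 + (1 / 12 - s ^ 2 / 2) * 0 - s / 12 * 0 - s ^ 2 / 4 * 0
        + (s / 2 + s ^ 2 / 2)) = s / 2 + s ^ 2 / 2 := by ring
  rw [h0] at main
  refine main.congr' ?_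
  filter_upwards [eventually_gt_atTop 0] with N h2
  have h2' : (0 : ℝ) < N := by exact_mod_cast h2
  have hlog : Real.log (s + N) = Real.log N + Real.log (1 + s * (1 / N)) := by
    rw [← Real.log_mul h2'.ne' (by positivity)]
    congr 1; field_simp; ring
  simp only [d]
  unfold bgB bgU bgV
  rw [hlog]
  field_simp
  ring

lemma bgT_summable {s : ℝ} (hs : 0 < s) : Summable (bgT s) := by
  have h1 : Summable (fun k : ℕ => 2 * s ^ 3 * (1 / ((k : ℝ) + 1) ^ 2)) := by
    apply Summable.mul_left
    have := (summable_nat_add_iff 1).2 (Real.summable_one_div_nat_pow.2 (by norm_num : 1 < 2))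
    simpa using this
  refine Summable.of_norm_bounded_eventually_nat h1 ?_
  have hN : Tendsto (fun N : ℕ => s * ((1 : ℝ) / ((N : ℝ) + 1))) atTop (nhds 0) := by
    simpa using tendsto_one_div_add_atTop_nhds_zero_nat.const_mul s
  filter_upwards [hN.eventually (gt_mem_nhds (by norm_num : (0:ℝ) < 1 / 2))] with k hk
  have hk0 : (0 : ℝ) < k + 1 := by positivity
  have h := bg_log2 (u := s * (1 / ((k : ℝ) + 1))) (by positivity) hk.le
  have : bgT s k = ((k : ℝ) + 1) * (Real.log (1 + s * (1 / ((k : ℝ) + 1))) -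
      (s * (1 / ((k : ℝ) + 1)) - (s * (1 / ((k : ℝ) + 1))) ^ 2 / 2)) := by
    unfold bgT
    rw [show s * (1 / ((k : ℝ) + 1)) = s / (k + 1) by ring]
    field_simp
    ring
  rw [this, norm_mul, Real.norm_eq_abs, Real.norm_eq_abs, abs_of_pos hk0]
  calc _ ≤ ((k : ℝ) + 1) * (2 * (s * (1 / ((k : ℝ) + 1))) ^ 3) := by gcongr
    _ = _ := by field_simp

lemma bg_real_main {Z : ℝ} (hZ : Tendsto bgA atTop (nhds (-Z))) {s : ℝ} (hs : 2 ≤ s) :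
    |s / 2 * Real.log (2 * π) - ((1 + Real.eulerMascheroniConstant) * s ^ 2 + s) / 2
      + ∑' k, bgT s k - (s ^ 2 / 2 * (Real.log s - 3 / 2) - Real.log s / 12
        + s * (Real.log (2 * π) / 2) + Z)| ≤ 16 / s ^ 2 := by
  have hs0 : 0 < s := by linarith
  have h1 := (bgT_summable hs0).hasSum.tendsto_sum_nat
  have h2 := (((h1.sub ((bgB_tendsto hs0).add_const (s * bgV s - bgU s))).add hZ).sub
    (Real.tendsto_harmonic_sub_log.const_mul (s ^ 2 / 2)))
  have h3 : Tendsto (fun N : ℕ => ∑ k ∈ Finset.range N, (bgE (s + k) - s * bgL (s + k))) atTop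
      (nhds (s / 2 * Real.log (2 * π) - ((1 + Real.eulerMascheroniConstant) * s ^ 2 + s) / 2
      + ∑' k, bgT s k - (s ^ 2 / 2 * (Real.log s - 3 / 2) - Real.log s / 12
        + s * (Real.log (2 * π) / 2) + Z))) := by
    refine (h2.congr fun N => ?_).trans (le_of_eq ?_)
    · rw [bg_S_id hs0]; ring
    · congr 1
      unfold bgU bgV
      field_simp
      ring
  exact le_of_tendsto h3.abs (Eventually.of_forall fun N => bg_R_bound hs N)

lemma bg_mv {g g' : ℝ → ℂ} {M : ℝ} (hM : 0 ≤ M) (h0 : g 0 = 0)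
    (hd : ∀ t ∈ Set.Icc (0 : ℝ) 1, HasDerivAt g (g' t) t)
    (hb : ∀ t ∈ Set.Icc (0 : ℝ) 1, ‖g' t‖ ≤ M) : ∀ t ∈ Set.Icc (0 : ℝ) 1, ‖g t‖ ≤ M := by
  intro t ht
  have := norm_image_sub_le_of_norm_deriv_le_segment' (a := 0) (b := 1) (f := g) (f' := g') (C := M)
    (fun x hx => (hd x hx).hasDerivWithinAt) (fun x hx => hb x ⟨hx.1, hx.2.le⟩) t ht
  rw [h0, sub_zero, sub_zero] at this
  exact this.trans (by nlinarith [ht.2])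

lemma bg_EM {F f f1 f2 f3 f4 : ℝ → ℂ} {x M : ℝ} (hM : 0 ≤ M)
    (hF : ∀ y, x ≤ y → HasDerivAt F (f y) y) (hf : ∀ y, x ≤ y → HasDerivAt f (f1 y) y)
    (hf1 : ∀ y, x ≤ y → HasDerivAt f1 (f2 y) y) (hf2 : ∀ y, x ≤ y → HasDerivAt f2 (f3 y) y)
    (hf3 : ∀ y, x ≤ y → HasDerivAt f3 (f4 y) y) (hb : ∀ y, x ≤ y → ‖f4 y‖ ≤ M) :
    ‖1 / 2 * (f (x + 1) + f x) - (F (x + 1) - F x) - 1 / 12 * (f1 (x + 1) - f1 x)‖ ≤ M := by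
  have sh : ∀ {g g' : ℝ → ℂ}, (∀ y, x ≤ y → HasDerivAt g (g' y) y) → ∀ t ∈ Set.Icc (0 : ℝ) 1,
      HasDerivAt (fun t : ℝ => g (x + t)) (g' (x + t)) t := by
    intro g g' h t ht
    have := h (x + t) (by linarith [ht.1])
    exact this.comp_const_add x t
  have hid : ∀ t : ℝ, HasDerivAt (fun t : ℝ => (t : ℂ)) 1 t := fun t => Complex.ofRealCLM.hasDerivAt
  have hsq : ∀ t : ℝ, HasDerivAt (fun t : ℝ => (t : ℂ) ^ 2) (2 * t) t := fun t => by
    exact ((hid t).fun_pow 2).congr_deriv (by simp)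
  let p0 : ℝ → ℂ := fun t => (t : ℂ) / 2 * (f (x + t) + f x) - (F (x + t) - F x)
    - (t : ℂ) ^ 2 / 12 * (f1 (x + t) - f1 x)
  let p1 : ℝ → ℂ := fun t => (f x - f (x + t)) / 2 + (t : ℂ) / 3 * f1 (x + t) + (t : ℂ) / 6 * f1 x
    - (t : ℂ) ^ 2 / 12 * f2 (x + t)
  let p2 : ℝ → ℂ := fun t => (f1 x - f1 (x + t)) / 6 + (t : ℂ) / 6 * f2 (x + t)
    - (t : ℂ) ^ 2 / 12 * f3 (x + t)
  let p3 : ℝ → ℂ := fun t => - ((t : ℂ) ^ 2 / 12 * f4 (x + t))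
  have b3 : ∀ t ∈ Set.Icc (0 : ℝ) 1, ‖p3 t‖ ≤ M := by
    intro t ht
    have h1 := hb (x + t) (by linarith [ht.1])
    simp only [p3, norm_neg, norm_mul, norm_div, norm_pow, Complex.norm_real]
    rw [Real.norm_of_nonneg ht.1]
    have : t ^ 2 / ‖(12 : ℂ)‖ ≤ 1 := by
      norm_num
      nlinarith [ht.1, ht.2]
    calc _ ≤ 1 * M := by gcongr
      _ = M := one_mul _
  have b2 : ∀ t ∈ Set.Icc (0 : ℝ) 1, ‖p2 t‖ ≤ M := by
    refine bg_mv hM (by simp [p2]) (fun t ht => ?_) b3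
    have := (((sh hf1 t ht).const_sub (f1 x)).div_const 6).add
      (((hid t).div_const 6).mul (sh hf2 t ht)) |>.sub (((hsq t).div_const 12).mul (sh hf3 t ht))
    refine this.congr_deriv ?_
    simp only [p3]; ring
  have b1 : ∀ t ∈ Set.Icc (0 : ℝ) 1, ‖p1 t‖ ≤ M := by
    refine bg_mv hM (by simp [p1]) (fun t ht => ?_) b2
    have := ((((sh hf t ht).const_sub (f x)).div_const 2).add
      (((hid t).div_const 3).mul (sh hf1 t ht))).add (((hid t).div_const 6).mul_const (f1 x))
       |>.sub (((hsq t).div_const 12).mul (sh hf2 t ht))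
    refine this.congr_deriv ?_
    simp only [p2]; ring
  have b0 : ∀ t ∈ Set.Icc (0 : ℝ) 1, ‖p0 t‖ ≤ M := by
    refine bg_mv hM (by simp [p0]) (fun t ht => ?_) b1
    have := ((((hid t).div_const 2).mul ((sh hf t ht).add_const (f x))).sub
      ((sh hF t ht).sub_const (F x)))
       |>.sub (((hsq t).div_const 12).mul ((sh hf1 t ht).sub_const (f1 x)))
    refine this.congr_deriv ?_
    simp only [p1]; ring
  have := b0 1 (by simp)
  simpa [p0] using this

lemma bg_cpow_deriv {y : ℝ} (hy : 0 < y) (c r : ℂ) :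
    HasDerivAt (fun y : ℝ => c * (y : ℂ) ^ r) (c * r * (y : ℂ) ^ (r - 1)) y := by
  by_cases hr : r = 0
  · subst hr
    simpa using hasDerivAt_const y c
  · exact ((hasDerivAt_ofReal_cpow_const hy.ne' hr).const_mul c).congr_deriv (by ring)

noncomputable def bgH (x : ℝ) (z : ℂ) : ℂ :=
  (x : ℂ) ^ (1 - z) / (1 - z) + 1 / 2 * (x : ℂ) ^ (-z) - z / 12 * (x : ℂ) ^ (-z - 1)

noncomputable def bgD (n : ℕ) (z : ℂ) : ℂ :=
  (((n : ℝ) + 1 + 1 : ℝ) : ℂ) ^ (-z) - (bgH ((n : ℝ) + 1 + 1) z - bgH ((n : ℝ) + 1) z)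

def bgS : Set ℂ := {z | -(3 / 2) < z.re ∧ ‖z‖ < 3 ∧ (z.re ≠ 1 ∨ 0 < z.im)}

lemma bgS_ne {z : ℂ} (hz : z ∈ bgS) : z ≠ 1 := by
  rintro rfl
  simpa using hz.2.2

lemma bgD_bound (n : ℕ) {z : ℂ} (hz : z ∈ bgS) :
    ‖bgD n z‖ ≤ 360 * ((n : ℝ) + 1) ^ (-(5 / 2) : ℝ) := by
  have hz1 := bgS_ne hz
  have hz1' : 1 - z ≠ 0 := sub_ne_zero.2 hz1.symm
  have hx : (0 : ℝ) < (n : ℝ) + 1 := by positivity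
  have key := bg_EM (x := (n : ℝ) + 1) (M := 360 * ((n : ℝ) + 1) ^ (-(5 / 2) : ℝ))
    (F := fun y => 1 / (1 - z) * (y : ℂ) ^ (1 - z))
    (f := fun y => 1 * (y : ℂ) ^ (-z))
    (f1 := fun y => (1 * (-z)) * (y : ℂ) ^ (-z - 1))
    (f2 := fun y => (1 * (-z) * (-z - 1)) * (y : ℂ) ^ (-z - 1 - 1))
    (f3 := fun y => (1 * (-z) * (-z - 1) * (-z - 1 - 1)) * (y : ℂ) ^ (-z - 1 - 1 - 1))
    (f4 := fun y => (1 * (-z) * (-z - 1) * (-z - 1 - 1) * (-z - 1 - 1 - 1)) *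
      (y : ℂ) ^ (-z - 1 - 1 - 1 - 1))
    (by positivity)
    (fun y hy => by
      refine (bg_cpow_deriv (by linarith) _ _).congr_deriv ?_
      rw [show 1 - z - 1 = -z by ring]
      field_simp)
    (fun y hy => bg_cpow_deriv (by linarith) _ _)
    (fun y hy => bg_cpow_deriv (by linarith) _ _)
    (fun y hy => bg_cpow_deriv (by linarith) _ _)
    (fun y hy => bg_cpow_deriv (by linarith) _ _)
    (fun y hy => by
      have hy0 : 0 < y := by linarith
      rw [norm_mul, Complex.norm_cpow_eq_rpow_re_of_pos hy0]
      have hn : ‖z‖ ≤ 3 := hz.2.1.le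
      have e1 : ‖-z‖ ≤ 3 := by rwa [norm_neg]
      have e2 : ‖-z - 1‖ ≤ 4 := (norm_sub_le _ _).trans (by rw [norm_one]; linarith)
      have e3 : ‖-z - 1 - 1‖ ≤ 5 := (norm_sub_le _ _).trans (by rw [norm_one]; linarith)
      have e4 : ‖-z - 1 - 1 - 1‖ ≤ 6 := (norm_sub_le _ _).trans (by rw [norm_one]; linarith)
      have e5 : ‖1 * (-z) * (-z - 1) * (-z - 1 - 1) * (-z - 1 - 1 - 1)‖ ≤ 360 := by
        rw [norm_mul, norm_mul, norm_mul, norm_mul, norm_one]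
        calc _ ≤ (1 : ℝ) * 3 * 4 * 5 * 6 := by gcongr
          _ = 360 := by norm_num
      have hn0 : (0 : ℝ) ≤ n := Nat.cast_nonneg n
      have e6 : y ^ (-z - 1 - 1 - 1 - 1).re ≤ ((n : ℝ) + 1) ^ (-(5 / 2) : ℝ) := by
        calc y ^ (-z - 1 - 1 - 1 - 1).re ≤ y ^ (-(5 / 2) : ℝ) := by
              apply Real.rpow_le_rpow_of_exponent_le (by linarith)
              have := hz.1
              simp only [Complex.sub_re, Complex.neg_re, Complex.one_re]
              linarith
          _ ≤ _ := Real.rpow_le_rpow_of_nonpos hx hy (by norm_num)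
      gcongr)
  refine le_trans (le_of_eq ?_) key
  congr 1
  unfold bgD bgH
  ring

lemma bg_summable : Summable (fun n : ℕ => 360 * ((n : ℝ) + 1) ^ (-(5 / 2) : ℝ)) := by
  apply Summable.mul_left
  have := (summable_nat_add_iff 1).2 (Real.summable_nat_rpow.2 (by norm_num : (-(5 / 2) : ℝ) < -1))
  simpa using this

lemma bgS_open : IsOpen bgS := by
  have : bgS = {z : ℂ | -(3 / 2) < z.re} ∩ ({z : ℂ | ‖z‖ < 3} ∩
      ({z : ℂ | z.re ≠ 1} ∪ {z : ℂ | 0 < z.im})) := by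
    ext z; simp [bgS]
  rw [this]
  refine (isOpen_lt continuous_const continuous_re).inter
    ((isOpen_lt continuous_norm continuous_const).inter
    (IsOpen.union ?_ (isOpen_lt continuous_const continuous_im)))
  exact isOpen_ne_fun continuous_re continuous_const

lemma bgS_base : (1 + I : ℂ) ∈ bgS := by
  refine ⟨by norm_num, ?_, by simp⟩
  calc ‖(1 + I : ℂ)‖ ≤ ‖(1 : ℂ)‖ + ‖I‖ := norm_add_le _ _
    _ < 3 := by norm_num

lemma bgS_conn : IsPreconnected bgS := by
  have : StarConvex ℝ (1 + I : ℂ) bgS := by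
    intro z hz a b ha hb hab
    obtain ⟨h1, h2, h3⟩ := hz
    have hre : (a • (1 + I : ℂ) + b • z).re = a + b * z.re := by simp
    have him : (a • (1 + I : ℂ) + b • z).im = a + b * z.im := by simp
    refine ⟨?_, ?_, ?_⟩
    · rw [hre]
      rcases eq_or_lt_of_le hb with hb0 | hb0
      · rw [← hb0]; linarith
      · nlinarith [mul_pos hb0 (by linarith : 0 < z.re + 3 / 2)]
    · have hc : Convex ℝ (Metric.ball (0 : ℂ) 3) := convex_ball _ _
      have := hc (x := 1 + I) (by simpa using bgS_base.2.1) (y := z) (by simpa using h2) ha hb hab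
      simpa using this
    · rw [hre, him]
      rcases eq_or_lt_of_le hb with hb0 | hb0
      · right; rw [← hb0]; linarith
      · rcases h3 with h3 | h3
        · left
          intro h
          apply h3
          have : b * (z.re - 1) = 0 := by linarith
          rcases mul_eq_zero.1 this with h | h <;> linarith
        · right; positivity
  exact (this.isPathConnected bgS_base).isConnected.isPreconnected

lemma bgH_diff {x : ℝ} (hx : 0 < x) {z : ℂ} (hz : z ≠ 1) : DifferentiableAt ℂ (bgH x) z := by
  have hx' : (x : ℂ) ≠ 0 := by exact_mod_cast hx.ne'
  have : 1 - z ≠ 0 := sub_ne_zero.2 hz.symm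
  unfold bgH
  have h1 : DifferentiableAt ℂ (fun z : ℂ => (x : ℂ) ^ (1 - z)) z :=
    DifferentiableAt.const_cpow (by fun_prop) (Or.inl hx')
  have h2 : DifferentiableAt ℂ (fun z : ℂ => (x : ℂ) ^ (-z)) z :=
    DifferentiableAt.const_cpow (by fun_prop) (Or.inl hx')
  have h3 : DifferentiableAt ℂ (fun z : ℂ => (x : ℂ) ^ (-z - 1)) z :=
    DifferentiableAt.const_cpow (by fun_prop) (Or.inl hx')
  exact ((h1.div (by fun_prop) this).add (h2.const_mul _)).sub
    ((differentiableAt_id.div_const _).mul h3)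

lemma bgD_diff (n : ℕ) : DifferentiableOn ℂ (bgD n) bgS := by
  intro z hz
  apply DifferentiableAt.differentiableWithinAt
  have hx' : ((((n : ℝ) + 1 + 1 : ℝ)) : ℂ) ≠ 0 := by
    have : ((n : ℝ) + 1 + 1 : ℝ) ≠ 0 := by positivity
    exact_mod_cast this
  have h2 : DifferentiableAt ℂ (fun z : ℂ => (((n : ℝ) + 1 + 1 : ℝ) : ℂ) ^ (-z)) z :=
    DifferentiableAt.const_cpow (by fun_prop) (Or.inl hx')
  exact h2.sub ((bgH_diff (by positivity) (bgS_ne hz)).sub (bgH_diff (by positivity) (bgS_ne hz)))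

lemma bg_partial (N : ℕ) (z : ℂ) : ∑ n ∈ Finset.range N, bgD n z =
    ∑ n ∈ Finset.range (N + 1), 1 / ((n : ℂ) + 1) ^ z - 1 - bgH ((N : ℝ) + 1) z + bgH 1 z := by
  induction N with
  | zero => simp
  | succ n ih =>
    rw [Finset.sum_range_succ, ih, Finset.sum_range_succ _ (n + 1)]
    unfold bgD
    rw [cpow_neg]
    push_cast
    ring

lemma bgH_tendsto {z : ℂ} (hz : 1 < z.re) :
    Tendsto (fun N : ℕ => bgH ((N : ℝ) + 1) z) atTop (nhds 0) := by
  have key : ∀ w : ℂ, w.re < 0 →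
      Tendsto (fun N : ℕ => (((N : ℝ) + 1 : ℝ) : ℂ) ^ w) atTop (nhds 0) := by
    intro w hw
    rw [tendsto_zero_iff_norm_tendsto_zero]
    have h1 : Tendsto (fun N : ℕ => (N : ℝ) + 1) atTop atTop :=
      tendsto_atTop_add_const_right _ _ tendsto_natCast_atTop_atTop
    have h2 := (tendsto_rpow_neg_atTop (y := -w.re) (by linarith)).comp h1
    refine h2.congr fun N => ?_
    rw [Complex.norm_cpow_eq_rpow_re_of_pos (by positivity)]
    simp
  have := (((key (1 - z) (by simpa using hz)).div_const (1 - z)).add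
    ((key (-z) (by simp; linarith)).const_mul (1 / 2))).sub
    ((key (-z - 1) (by simp; linarith)).const_mul (z / 12))
  simpa [bgH] using this

lemma bg_zeta_of_re {z : ℂ} (hz : z ∈ bgS) (h1 : 1 < z.re) :
    riemannZeta z = 1 - bgH 1 z + ∑' n, bgD n z := by
  have hs : Summable (fun n => bgD n z) := Summable.of_norm_bounded bg_summable
    (fun n => bgD_bound n hz)
  have t1 := hs.hasSum.tendsto_sum_nat
  have hz' : Summable (fun n : ℕ => 1 / ((n : ℂ) + 1) ^ z) := by
    have := (summable_nat_add_iff 1).2 (Complex.summable_one_div_nat_cpow.2 h1)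
    simpa using this
  have t2 := (tendsto_add_atTop_iff_nat 1).2 hz'.hasSum.tendsto_sum_nat
  rw [← zeta_eq_tsum_one_div_nat_add_one_cpow h1] at t2
  have t3 := ((t2.sub_const 1).sub (bgH_tendsto h1)).add_const (bgH 1 z)
  have := tendsto_nhds_unique t1 (t3.congr fun N => (bg_partial N z).symm)
  rw [this]; ring

lemma bg_zeta : Set.EqOn riemannZeta (fun z => 1 - bgH 1 z + ∑' n, bgD n z) bgS := by
  have hd : DifferentiableOn ℂ (fun z => 1 - bgH 1 z + ∑' n, bgD n z) bgS := by
    refine DifferentiableOn.add (fun z hz => ?_)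
      (differentiableOn_tsum_of_summable_norm bg_summable bgD_diff bgS_open
        (fun n w hw => bgD_bound n hw))
    exact ((bgH_diff one_pos (bgS_ne hz)).const_sub 1).differentiableWithinAt
  have hζ : DifferentiableOn ℂ riemannZeta bgS := fun z hz =>
    (differentiableAt_riemannZeta (bgS_ne hz)).differentiableWithinAt
  have h2 : (2 : ℂ) ∈ bgS := ⟨by norm_num, by norm_num, by norm_num⟩
  refine (hζ.analyticOnNhd bgS_open).eqOn_of_preconnected_of_eventuallyEq
    (hd.analyticOnNhd bgS_open) bgS_conn h2 ?_
  filter_upwards [bgS_open.mem_nhds h2,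
    (isOpen_lt continuous_const continuous_re).mem_nhds (show (1 : ℝ) < (2 : ℂ).re by norm_num)]
    with z hz1 hz2
  exact bg_zeta_of_re hz1 hz2

lemma bgH_deriv {x : ℝ} (hx : 0 < x) : HasDerivAt (bgH x) ((-(bgU x) : ℝ) : ℂ) (-1) := by
  have hx' : (x : ℂ) ≠ 0 := by exact_mod_cast hx.ne'
  have hid := hasDerivAt_id (-1 : ℂ)
  have h1 := (hid.const_sub 1).const_cpow (c := (x : ℂ)) (Or.inl hx')
  have h2 := hid.neg.const_cpow (c := (x : ℂ)) (Or.inl hx')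
  have h3 := (hid.neg.sub_const 1).const_cpow (c := (x : ℂ)) (Or.inl hx')
  have := ((h1.div (hid.const_sub 1) (by norm_num)).add (h2.const_mul (1 / 2))).sub
    ((hid.div_const 12).mul h3)
  refine (this.congr_deriv ?_)
  have e1 : (x : ℂ) ^ (1 - id (-1) : ℂ) = (x : ℂ) ^ 2 := by
    rw [id, show (1 - -1 : ℂ) = ((2 : ℕ) : ℂ) by norm_num, cpow_natCast]
  have e2 : (x : ℂ) ^ ((-id) (-1 : ℂ) : ℂ) = x := by simp
  have e3 : (x : ℂ) ^ ((-id) (-1 : ℂ) - 1 : ℂ) = 1 := by simp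
  rw [e1, e2, e3, ← Complex.ofReal_log hx.le]
  unfold bgU
  push_cast
  simp only [id]
  ring

lemma bgD_deriv (n : ℕ) : deriv (bgD n) (-1) = ((-(((n : ℝ) + 1 + 1) * Real.log ((n : ℝ) + 1 + 1))
    + (bgU ((n : ℝ) + 1 + 1) - bgU ((n : ℝ) + 1)) : ℝ) : ℂ) := by
  have hx : (0 : ℝ) < (n : ℝ) + 1 + 1 := by positivity
  have hx' : ((((n : ℝ) + 1 + 1 : ℝ)) : ℂ) ≠ 0 := by exact_mod_cast hx.ne'
  have hid := hasDerivAt_id (-1 : ℂ)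
  have h2 := hid.neg.const_cpow (c := (((n : ℝ) + 1 + 1 : ℝ) : ℂ)) (Or.inl hx')
  have := h2.sub ((bgH_deriv hx).sub (bgH_deriv (by positivity : (0 : ℝ) < (n : ℝ) + 1)))
  have h := this.deriv
  have e2 : (((n : ℝ) + 1 + 1 : ℝ) : ℂ) ^ ((-id) (-1 : ℂ) : ℂ) = (((n : ℝ) + 1 + 1 : ℝ) : ℂ) := by simp
  rw [e2, ← Complex.ofReal_log hx.le] at h
  refine Eq.trans h ?_
  push_cast
  ring

lemma bg_partial' (N : ℕ) : ∑ n ∈ Finset.range N, (-(((n : ℝ) + 1 + 1) * Real.log ((n : ℝ) + 1 + 1))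
    + (bgU ((n : ℝ) + 1 + 1) - bgU ((n : ℝ) + 1))) = - bgA (N + 1) - bgU 1 := by
  induction N with
  | zero => simp [bgA]
  | succ n ih =>
    rw [Finset.sum_range_succ, ih]
    unfold bgA
    rw [Finset.sum_range_succ _ (n + 1)]
    push_cast
    ring

lemma bg_zeta_deriv : ∃ Z : ℝ, deriv riemannZeta (-1) = (Z : ℂ) ∧ Tendsto bgA atTop (nhds (-Z)) := by
  have hm : (-1 : ℂ) ∈ bgS := ⟨by norm_num, by norm_num, by norm_num⟩
  have hsum := hasSum_deriv_of_summable_norm bg_summable bgD_diff bgS_open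
        (fun n w hw => bgD_bound n hw) hm
  have hdt := (differentiableOn_tsum_of_summable_norm bg_summable bgD_diff bgS_open
        (fun n w hw => bgD_bound n hw)).differentiableAt (bgS_open.mem_nhds hm)
  have h1 : deriv riemannZeta (-1) = (bgU 1 : ℂ) + deriv (fun w => ∑' n, bgD n w) (-1) := by
    rw [(bg_zeta.eventuallyEq_of_mem (bgS_open.mem_nhds hm)).deriv_eq]
    refine ((((bgH_deriv one_pos).const_sub 1).add hdt.hasDerivAt).congr_deriv ?_).deriv
    push_cast
    ring
  have ht := hsum.tendsto_sum_nat
  simp only [bgD_deriv] at ht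
  simp only [← Complex.ofReal_sum, bg_partial'] at ht
  have hre := (Complex.continuous_re.tendsto _).comp ht
  have him := (Complex.continuous_im.tendsto _).comp ht
  have him0 : (deriv (fun w => ∑' n, bgD n w) (-1)).im = 0 := by
    refine (tendsto_nhds_unique (tendsto_const_nhds (x := (0 : ℝ))) (him.congr fun N => ?_)).symm
    simp only [Function.comp, Complex.ofReal_im]
  refine ⟨bgU 1 + (deriv (fun w => ∑' n, bgD n w) (-1)).re, ?_, ?_⟩
  · rw [h1]
    apply Complex.ext
    · simp
    · simp [him0]
  · rw [← tendsto_add_atTop_iff_nat 1]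
    have := (hre.add_const (bgU 1)).neg
    rw [add_comm (bgU 1)]
    refine this.congr fun N => ?_
    simp only [Function.comp, Complex.ofReal_re]
    ring

lemma bg_barnes {s : ℝ} (hs : 0 < s) : Complex.log (BarnesG ((s : ℂ) + 1)) =
    ((s / 2 * Real.log (2 * π) - ((1 + Real.eulerMascheroniConstant) * s ^ 2 + s) / 2
      + ∑' k, bgT s k : ℝ) : ℂ) := by
  have hprod : ∏' n : ℕ, (1 + (s : ℂ) / (n + 1)) ^ (n + 1) *
      Complex.exp (-(s : ℂ) + (s : ℂ) ^ 2 / (2 * (n + 1))) = Complex.exp ((∑' k, bgT s k : ℝ) : ℂ) := by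
    have h1 : HasSum (fun k => ((bgT s k : ℝ) : ℂ)) ((∑' k, bgT s k : ℝ) : ℂ) :=
      Complex.hasSum_ofReal.2 (bgT_summable hs).hasSum
    rw [← h1.cexp.tprod_eq]
    congr 1
    ext n
    have hp : (0 : ℝ) < 1 + s / ((n : ℝ) + 1) := by positivity
    have : (1 + (s : ℂ) / (n + 1)) = Complex.exp ((Real.log (1 + s / ((n : ℝ) + 1)) : ℝ) : ℂ) := by
      rw [← Complex.ofReal_exp, Real.exp_log hp]
      push_cast; rfl
    simp only [Function.comp]
    rw [this, ← Complex.exp_nat_mul, ← Complex.exp_add]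
    unfold bgT
    push_cast
    rfl
  unfold BarnesG
  rw [add_sub_cancel_right, hprod]
  have h2 : (2 * (π : ℂ)) ^ ((s : ℂ) / 2) = Complex.exp ((s / 2 * Real.log (2 * π) : ℝ) : ℂ) := by
    have hp : (0 : ℝ) < 2 * π := by positivity
    rw [show (2 * (π : ℂ)) = ((2 * π : ℝ) : ℂ) by push_cast; rfl,
      Complex.cpow_def_of_ne_zero (by exact_mod_cast hp.ne'), ← Complex.ofReal_log hp.le]
    push_cast
    congr 1
    ring
  rw [h2, ← Complex.exp_add, ← Complex.exp_add]
  rw [show ((s / 2 * Real.log (2 * π) : ℝ) : ℂ) +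
      -(((1 + (Real.eulerMascheroniConstant : ℂ)) * (s : ℂ) ^ 2 + (s : ℂ)) / 2) +
      ((∑' k, bgT s k : ℝ) : ℂ) =
    ((s / 2 * Real.log (2 * π) - ((1 + Real.eulerMascheroniConstant) * s ^ 2 + s) / 2
      + ∑' k, bgT s k : ℝ) : ℂ) by rw [Complex.ofReal_add, Complex.ofReal_sub]; push_cast; ring]
  rw [← Complex.ofReal_exp, ← Complex.ofReal_log (Real.exp_pos _).le, Real.log_exp]

theorem stmt_11 :
    (fun s : ℝ => Complex.log (BarnesG ((s : ℂ) + 1)) -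
        (((s : ℂ) ^ 2 / 2) * ((Real.log s : ℂ) - 3 / 2) - (Real.log s : ℂ) / 12
          - (s : ℂ) * deriv riemannZeta 0 + deriv riemannZeta (-1)))
      =O[atTop] fun s : ℝ => s ^ (-2 : ℤ) := by
  obtain ⟨Z, hZ, hA⟩ := bg_zeta_deriv
  refine IsBigO.of_bound 16 ?_
  filter_upwards [eventually_ge_atTop 2] with s hs
  have hs0 : 0 < s := by linarith
  have h := bg_real_main hA hs
  have h0 : deriv riemannZeta 0 = ((-(Real.log (2 * π) / 2) : ℝ) : ℂ) := by
    rw [deriv_riemannZeta_zero]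
    have : Complex.log (2 * (π : ℂ)) = ((Real.log (2 * π) : ℝ) : ℂ) := by
      rw [Complex.ofReal_log (by positivity)]; push_cast; rfl
    rw [this]
    push_cast
    ring
  rw [bg_barnes hs0, hZ, h0]
  rw [← Real.norm_eq_abs, ← Complex.norm_real] at h
  have e : ‖s ^ (-2 : ℤ)‖ = 1 / s ^ 2 := by
    rw [Real.norm_of_nonneg (by positivity), zpow_neg, one_div]; rfl
  rw [e, mul_one_div]
  refine le_trans (le_of_eq ?_) h
  congr 1
  push_cast
  ring
end
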